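/- Assume that for every cardinal λ > ℵ₁, every stationary family 𝒜 ⊆ [λ]^{ℵ₀} reflects in some set A ⊆ λ of cardinality ℵ₁. Then the Singular Cardinal Hypothesis holds: for all infinite cardinals λ and κ, λ^κ ≤ λ⁺ + 2^κ. -/

import Mathlib

open Cardinal Set

namespace ReflSCH

/-- `[B]^{<ℵ₁}`: the family of subsets of `B` of cardinality `< ℵ₁`,
i.e. the countable subsets of `B`. -/
def small (B : Set Ordinal.{0}) : Set (Set Ordinal.{0}) := {a | a ⊆ B ∧ a.Countable}

/-- `[B]^{ℵ₀}`: the countably infinite subsets of `B`. -/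
def ctblInf (B : Set Ordinal.{0}) : Set (Set Ordinal.{0}) :=
  {a | a ⊆ B ∧ a.Countable ∧ a.Infinite}

/-- A family is closed if the union of every nonempty `⊆`-increasing chain of fewer
than `ℵ₁` (i.e. countably many) of its members belongs to it. -/
def ClosedFam (𝒜 : Set (Set Ordinal.{0})) : Prop :=
  ∀ D : Set (Set Ordinal.{0}), D ⊆ 𝒜 → D.Nonempty → IsChain (· ⊆ ·) D → D.Countable →
    ⋃₀ D ∈ 𝒜

/-- A family is unbounded in `[B]^{<ℵ₁}` if every member of `[B]^{<ℵ₁}` is contained in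
some member of the family. -/
def UnbFam (B : Set Ordinal.{0}) (𝒜 : Set (Set Ordinal.{0})) : Prop :=
  ∀ y ∈ small B, ∃ x ∈ 𝒜, y ⊆ x

/-- A club of `[B]^{<ℵ₁}`. -/
def ClubFam (B : Set Ordinal.{0}) (𝒜 : Set (Set Ordinal.{0})) : Prop :=
  𝒜 ⊆ small B ∧ ClosedFam 𝒜 ∧ UnbFam B 𝒜

/-- The family `𝒜` meets every club of `[B]^{<ℵ₁}`. -/
def MeetsClubs (B : Set Ordinal.{0}) (𝒜 : Set (Set Ordinal.{0})) : Prop :=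
  ∀ 𝒞 : Set (Set Ordinal.{0}), ClubFam B 𝒞 → (𝒜 ∩ 𝒞).Nonempty

/-- Stationarity in `[B]^{<ℵ₁}`. -/
def StatFam (B : Set Ordinal.{0}) (𝒜 : Set (Set Ordinal.{0})) : Prop :=
  𝒜 ⊆ small B ∧ MeetsClubs B 𝒜

/-- `𝒜` reflects in `B₂` iff `𝒜 ∩ [B₂]^{ℵ₀}` is stationary in `[B₂]^{<ℵ₁}`. -/
def Reflects (𝒜 : Set (Set Ordinal.{0})) (B₂ : Set Ordinal.{0}) : Prop :=
  StatFam B₂ (𝒜 ∩ ctblInf B₂)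

/-- `f <_{J^{bd}_ω} g`: `f n < g n` for all but finitely many `n`. -/
def ltBd (f g : ℕ → Ordinal.{0}) : Prop := ∃ m : ℕ, ∀ n ≥ m, f n < g n

/-- `⟨f_α : α < lam.ord⟩` witnesses `lam = tcf (∏_n lamseq n, <_{J^{bd}_ω})`:
each `f_α ∈ ∏_n lamseq n`, the sequence is `<_{J^{bd}_ω}`-increasing, and it is
cofinal in the product. -/
def TcfWitness (lam : Cardinal.{0}) (lamseq : ℕ → Cardinal.{0})
    (f : Ordinal.{0} → ℕ → Ordinal.{0}) : Prop :=
  (∀ α < lam.ord, ∀ n : ℕ, f α n < (lamseq n).ord) ∧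
  (∀ α < lam.ord, ∀ β < lam.ord, α < β → ltBd (f α) (f β)) ∧
  (∀ g : ℕ → Ordinal.{0}, (∀ n : ℕ, g n < (lamseq n).ord) → ∃ α < lam.ord, ltBd g (f α))

/-- The sequence `⟨f_i : i ∈ I⟩` is free. -/
def Free (I : Set Ordinal.{0}) (f : Ordinal.{0} → ℕ → Ordinal.{0}) : Prop :=
  ∃ nf : Ordinal.{0} → ℕ, ∀ i ∈ I, ∀ j ∈ I, i < j →
    ∀ n : ℕ, nf i ≤ n → nf j ≤ n → f i n < f j n

section

/-- A well ordered type behaving as a regular uncountable cardinal. -/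
structure RegT (L : Type) [LinearOrder L] : Prop where
  wf : WellFounded ((· < ·) : L → L → Prop)
  unc : ℵ₀ < #L
  bd : ∀ S : Set L, #S < #L → ∃ b, ∀ x ∈ S, x < b
  seg : ∀ x : L, #(Iio x) < #L

theorem RegT.of_reg {κ : Cardinal.{0}} (h : κ.IsRegular) (hu : ℵ₀ < κ) : RegT κ.ord.ToType where
  wf := wellFounded_lt
  unc := by simpa using hu
  bd := by
    intro S hS
    have hS' : #S < κ := by simpa using hS
    by_contra hcon
    have : IsCofinal S := by
      by_contra h2
      rw [not_isCofinal_iff] at h2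
      exact hcon h2
    have h3 := Order.cof_le this
    rw [Ordinal.cof_toType, h.cof_ord] at h3
    exact absurd hS' (not_lt.2 h3)
  seg := by
    intro x
    simpa using Cardinal.mk_Iio_toType_ord_lt x

variable {L : Type} [LinearOrder L]

theorem RegT.bdr (R : RegT L) {ι : Type} (hι : #ι < #L) (f : ι → L) : ∃ b, ∀ i, f i < b := by
  obtain ⟨b, hb⟩ := R.bd (range f) (mk_range_le.trans_lt hι)
  exact ⟨b, fun i => hb _ ⟨i, rfl⟩⟩

theorem RegT.bdc (R : RegT L) {S : Set L} (hS : S.Countable) : ∃ b, ∀ x ∈ S, x < b :=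
  R.bd S ((le_aleph0_iff_set_countable.2 hS).trans_lt R.unc)

theorem RegT.gt (R : RegT L) (x : L) : ∃ y, x < y := by
  obtain ⟨b, hb⟩ := R.bdc (countable_singleton x)
  exact ⟨b, hb x rfl⟩

theorem RegT.inf (R : RegT L) : Infinite L := Cardinal.infinite_iff.2 R.unc.le

theorem RegT.segc (R : RegT L) (x : L) : #(Iic x) < #L := by
  obtain ⟨y, hy⟩ := R.gt x
  exact (mk_le_mk_of_subset (fun z (hz : z ≤ x) => lt_of_le_of_lt hz hy)).trans_lt (R.seg y)

theorem RegT.lub (R : RegT L) {S : Set L} {b : L} (hb : ∀ x ∈ S, x ≤ b) : ∃ d, IsLUB S d := by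
  have hne : (upperBounds S).Nonempty := ⟨b, fun x hx => hb x hx⟩
  refine ⟨R.wf.min _ hne, R.wf.min_mem _ hne, fun z hz => ?_⟩
  exact not_lt.1 (R.wf.not_lt_min _ hz)

theorem lt_lub {S : Set L} {d x : L} (h : IsLUB S d) (hx : x < d) : ∃ z ∈ S, x < z := by
  by_contra hc
  push Not at hc
  exact absurd (h.2 hc) (not_le.2 hx)

/-- dominate a function -/
theorem RegT.dom (R : RegT L) (F : L → L) : ∃ G : L → L, ∀ x, x < G x ∧ ∀ x' ≤ x, F x' < G x := by
  have : ∀ x, ∃ g, x < g ∧ ∀ x' ≤ x, F x' < g := by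
    intro x
    obtain ⟨b, hb⟩ := R.bdr (R.segc x) (fun z => F z)
    obtain ⟨c, hc⟩ := R.gt (max x b)
    exact ⟨c, (le_max_left _ _).trans_lt hc, fun x' hx' => (hb ⟨x', hx'⟩).trans
      ((le_max_right _ _).trans_lt hc)⟩
  choose G hG using this
  exact ⟨G, hG⟩

/-- cofinality omega points -/
def OmL (d : ℕ → L) (δ : L) : Prop := StrictMono d ∧ IsLUB (range d) δ

theorem OmL.lt {d : ℕ → L} {δ : L} (h : OmL d δ) (n : ℕ) : d n < δ :=
  (h.1 (Nat.lt_succ_self n)).trans_le (h.2.1 ⟨_, rfl⟩)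

theorem OmL.ex {d : ℕ → L} {δ x : L} (h : OmL d δ) (hx : x < δ) : ∃ n, x < d n := by
  obtain ⟨z, ⟨n, rfl⟩, hz⟩ := lt_lub h.2 hx
  exact ⟨n, hz⟩

theorem RegT.omega_pt (R : RegT L) (F : L → L) : ∃ (δ : L) (d : ℕ → L), OmL d δ ∧ ∀ x < δ, F x < δ := by
  obtain ⟨G, hG⟩ := R.dom F
  have := R.inf
  obtain ⟨x0⟩ : Nonempty L := inferInstance
  let d : ℕ → L := fun n => G^[n] x0
  have hd : ∀ n, d (n+1) = G (d n) := fun n => Function.iterate_succ_apply' G n x0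
  have hmono : StrictMono d := strictMono_nat_of_lt_succ (fun n => by rw [hd]; exact (hG _).1)
  obtain ⟨b, hb⟩ := R.bdc (countable_range d)
  obtain ⟨δ, hδ⟩ := R.lub (fun x hx => (hb x hx).le)
  have ho : OmL d δ := ⟨hmono, hδ⟩
  refine ⟨δ, d, ho, fun x hx => ?_⟩
  obtain ⟨n, hn⟩ := ho.ex hx
  exact ((hG _).2 x hn.le).trans (by rw [← hd]; exact ho.lt _)

/-- Omega one -/
abbrev Om : Type := (Cardinal.aleph 1).ord.ToType

theorem mk_Om : #Om = aleph 1 := by simp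

theorem regOm : RegT Om := RegT.of_reg isRegular_aleph_one aleph0_lt_aleph_one

theorem Om_seg (x : Om) : (Iio x).Countable := by
  have := regOm.seg x
  rw [mk_Om] at this
  rw [← le_aleph0_iff_set_countable]
  exact Order.lt_succ_iff.1 (this.trans_eq succ_aleph0.symm)

theorem RegT.rank (R : RegT L) (a : Set L) (ha : a.Countable) : ∃ h : L → Om, StrictMonoOn h a := by
  classical
  have hb : ∀ S : Set Om, ∃ b : Om, S.Countable → ∀ x ∈ S, x < b := by
    intro S
    by_cases hS : S.Countable
    · obtain ⟨b, hb⟩ := regOm.bdc hS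
      exact ⟨b, fun _ => hb⟩
    · have := regOm.inf
      exact ⟨Classical.arbitrary _, fun h => absurd h hS⟩
  choose B hB using hb
  let h : L → Om := R.wf.fix (fun x ih => B {v | ∃ w, ∃ hw : w < x, w ∈ a ∧ ih w hw = v})
  have heq : ∀ x, h x = B {v | ∃ w, ∃ hw : w < x, w ∈ a ∧ h w = v} := fun x => by
    rw [show h x = _ from R.wf.fix_eq _ x]
  refine ⟨h, fun x hx y hy hxy => ?_⟩
  rw [heq y]
  apply hB
  · refine (ha.image h).mono ?_
    rintro v ⟨w, -, hw, rfl⟩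
    exact ⟨w, hw, rfl⟩
  · exact ⟨x, hxy, hx, rfl⟩

/-- cofinality omega one closed points -/
theorem RegT.om1_pt (R : RegT L) (h1 : aleph 1 < #L) (F : L → L) (x0 : L) :
    ∃ y, x0 < y ∧ (∀ x < y, F x < y) ∧ ∀ c : Set L, c.Countable → (∀ x ∈ c, x < y) →
      ∃ z < y, ∀ x ∈ c, x < z := by
  classical
  obtain ⟨G, hG⟩ := R.dom F
  have hb : ∀ (i : Om) (f : ∀ j : Om, j < i → L), ∃ b : L, x0 < b ∧ ∀ j hj, G (f j hj) < b := by
    intro i f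
    have hc : #(Iio i) < #L := by
      refine (regOm.seg i).trans ?_
      rw [mk_Om]; exact h1
    obtain ⟨b, hb⟩ := R.bdr hc (fun j => G (f j.1 j.2))
    obtain ⟨c, hc⟩ := R.gt (max x0 b)
    exact ⟨c, (le_max_left _ _).trans_lt hc, fun j hj => (hb ⟨j, hj⟩).trans
      ((le_max_right _ _).trans_lt hc)⟩
  choose B hB0 hB using hb
  let g : Om → L := regOm.wf.fix B
  have heq : ∀ i, g i = B i (fun j _ => g j) := fun i => regOm.wf.fix_eq _ i
  have hg0 : ∀ i, x0 < g i := fun i => by rw [heq]; exact hB0 _ _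
  have hg : ∀ i j, j < i → G (g j) < g i := fun i j hj => by
    rw [heq i]; exact hB i (fun j _ => g j) j hj
  have hm : StrictMono g := fun j i hj => (hG _).1.trans (hg i j hj)
  obtain ⟨b, hb⟩ := R.bdr (by rw [mk_Om]; exact h1) g
  obtain ⟨y, hy⟩ := R.lub (S := range g) (b := b) (by rintro x ⟨i, rfl⟩; exact (hb i).le)
  have hlt : ∀ i, g i < y := fun i => by
    obtain ⟨j, hj⟩ := regOm.gt i
    exact (hm hj).trans_le (hy.1 ⟨j, rfl⟩)
  have hex : ∀ x, x < y → ∃ i, x < g i := fun x hx => by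
    obtain ⟨_, ⟨i, rfl⟩, h⟩ := lt_lub hy hx
    exact ⟨i, h⟩
  refine ⟨y, ?_, ?_, ?_⟩
  · have := regOm.inf
    exact (hg0 (Classical.arbitrary _)).trans (hlt _)
  · intro x hx
    obtain ⟨i, hi⟩ := hex x hx
    obtain ⟨j, hj⟩ := regOm.gt i
    exact ((hG _).2 x hi.le).trans ((hg j i hj).trans (hlt j))
  · intro c hc hcy
    have : ∀ x : c, ∃ i, x.1 < g i := fun x => hex x (hcy x x.2)
    choose I hI using this
    have := hc.to_subtype
    obtain ⟨j, hj⟩ := regOm.bdc (countable_range I)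
    exact ⟨g j, hlt j, fun x hx => (hI ⟨x, hx⟩).trans (hm (hj _ ⟨_, rfl⟩))⟩

/-- Ulam -/
theorem RegT.ulam (R : RegT L) (M : Type) (hM : ℵ₀ ≤ #M) (hL : #L = Order.succ #M) :
    ∃ s : L → Om, ∀ (i : Om) (F : L → L), ∃ (δ : L) (d : ℕ → L), OmL d δ ∧ i ≤ s δ ∧
      ∀ x < δ, F x < δ := by
  classical
  have hML : #M < #L := by rw [hL]; exact Order.lt_succ _
  have he : ∀ δ : L, ∃ e : L → M, InjOn e (Iio δ) := by
    intro δ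
    have h := R.seg δ
    rw [hL, Order.lt_succ_iff] at h
    obtain ⟨f⟩ := h
    have : Nonempty M := (Cardinal.infinite_iff.2 hM).nonempty
    refine ⟨fun x => if h : x < δ then f ⟨x, h⟩ else Classical.arbitrary _, fun x hx y hy hxy => ?_⟩
    have hx' : x < δ := hx
    have hy' : y < δ := hy
    simp only [hx', hy', dif_pos] at hxy
    exact congrArg Subtype.val (f.injective hxy)
  choose e he using he
  have h1 : ∀ η : L, ∃ ξ : M, ∀ F : L → L, ∃ (δ : L) (d : ℕ → L), OmL d δ ∧ η < δ ∧ e δ η = ξ ∧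
      ∀ x < δ, F x < δ := by
    intro η
    by_contra hcon
    push Not at hcon
    choose F hF using hcon
    have : ∀ x, ∃ b, η < b ∧ ∀ ξ, F ξ x < b := fun x => by
      obtain ⟨b, hb⟩ := R.bdr hML (fun ξ => F ξ x)
      obtain ⟨c, hc⟩ := R.gt (max η b)
      exact ⟨c, (le_max_left _ _).trans_lt hc, fun ξ => (hb ξ).trans
        ((le_max_right _ _).trans_lt hc)⟩
    choose F' h0 hF' using this
    obtain ⟨δ, d, ho, hcl⟩ := R.omega_pt F'
    have hη : η < δ := (h0 (d 0)).trans (hcl _ (ho.lt 0))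
    obtain ⟨x, hx, hx'⟩ := hF _ δ d ho hη rfl
    exact absurd ((hF' x (e δ η)).trans (hcl x hx)) (not_lt.2 hx')
  choose ξ hξ using h1
  obtain ⟨ξ0, hξ0⟩ : ∃ ξ0, aleph 1 ≤ #(ξ ⁻¹' {ξ0}) := by
    by_contra hcon
    push Not at hcon
    have : #L ≤ #M * ℵ₀ := by
      have h2 : #L = Cardinal.sum (fun m : M => #(ξ ⁻¹' {m})) := by
        rw [← mk_sigma]
        exact (Cardinal.mk_congr (Equiv.sigmaFiberEquiv ξ)).symm
      rw [h2]
      refine (sum_le_sum _ (fun _ => ℵ₀) fun m => ?_).trans ?_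
      · have := hcon m
        rw [← succ_aleph0] at this
        exact Order.lt_succ_iff.1 this
      · simp
    rw [mul_eq_left hM hM aleph0_ne_zero] at this
    exact absurd this (not_le.2 hML)
  rw [← mk_Om] at hξ0
  obtain ⟨g⟩ := hξ0
  have := regOm.inf
  refine ⟨fun δ => if h : ∃ i : Om, (g i).1 < δ ∧ e δ (g i).1 = ξ0 then h.choose
    else Classical.arbitrary _, fun i F => ?_⟩
  obtain ⟨δ, d, ho, hη, he', hcl⟩ := hξ (g i).1 F
  have hgi : ξ (g i).1 = ξ0 := (g i).2
  rw [hgi] at he'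
  refine ⟨δ, d, ho, ?_, hcl⟩
  have hex : ∃ i : Om, (g i).1 < δ ∧ e δ (g i).1 = ξ0 := ⟨i, hη, he'⟩
  beta_reduce
  rw [dif_pos hex]
  have hs := hex.choose_spec
  have h3 := he δ hs.1 hη (hs.2.trans he'.symm)
  have h4 := g.injective (Subtype.ext h3)
  exact h4.ge

end

section

theorem escape (M : Type) (hM : ℵ₀ ≤ #M) (hp : ∀ ν < #M, ν ^ ℵ₀ < #M) (lam : Cardinal.{0})
    (hl : #M ≤ lam) (hl2 : lam < #M ^ ℵ₀) {ι : Type} (hι : #ι ≤ lam) (E : ι → Set M)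
    (hE : ∀ i, #(E i) < #M) : ∃ x : ℕ → M, ∀ i, {k | x k ∈ E i}.Finite := by
  by_contra hcon
  push Not at hcon
  have : Infinite M := Cardinal.infinite_iff.2 hM
  obtain ⟨c⟩ : Nonempty (List M ↪ M) := by
    have := Cardinal.mk_list_eq_mk M
    exact this.le
  have h1 : ∀ f : ℕ → M, ∃ (i : ι) (k : ℕ → ℕ), (∀ n, n ≤ k n) ∧
      ∀ n, c ((List.range (k n)).map f) ∈ E i := by
    intro f
    obtain ⟨i, hi⟩ := hcon (fun k => c ((List.range k).map f))
    have hi2 : ∀ n, ∃ k, n ≤ k ∧ c ((List.range k).map f) ∈ E i := by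
      intro n
      obtain ⟨k, hk, hnk⟩ := Set.Infinite.exists_gt hi n
      exact ⟨k, hnk.le, hk⟩
    choose k hk using hi2
    exact ⟨i, k, fun n => (hk n).1, fun n => (hk n).2⟩
  choose i k hk hE' using h1
  let Φ : (ℕ → M) → Σ j : ι, (ℕ → E j) := fun f =>
    ⟨i f, fun n => ⟨c ((List.range (k f n)).map f), hE' f n⟩⟩
  let Ψ : (Σ j : ι, (ℕ → E j)) → ι × (ℕ → M) := fun p => (p.1, fun n => (p.2 n).1)
  have hinj : Function.Injective Φ := by
    intro f g hfg
    have h2 := congrArg Ψ hfg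
    have h3 : ∀ n, (List.range (k f n)).map f = (List.range (k g n)).map g := fun n =>
      c.injective (congrFun (congrArg Prod.snd h2) n)
    funext m
    have h4 := h3 (m+1)
    have hlen := congrArg List.length h4
    simp only [List.length_map, List.length_range] at hlen
    rw [← hlen] at h4
    rw [List.map_inj_left] at h4
    exact h4 m (List.mem_range.2 (hk f (m+1)))
  have h5 := Cardinal.mk_le_of_injective hinj
  rw [mk_sigma] at h5
  have h6 : Cardinal.sum (fun j : ι => #(ℕ → E j)) ≤ lam := by
    refine (sum_le_sum _ (fun _ => #M) fun j => ?_).trans ?_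
    · have := hp _ (hE j)
      simpa using this.le
    · rw [sum_const]
      simp only [lift_id]
      exact (mul_le_mul' hι hl).trans (mul_eq_self (hM.trans hl)).le
  have h7 : #(ℕ → M) = #M ^ ℵ₀ := by simp
  rw [h7] at h5
  exact absurd (h5.trans h6) (not_le.2 hl2)

variable {L : Type} [LinearOrder L]

def Afam (D : ℕ → L → Set L) (s : L → Om) : Set (Set L) :=
  {a | a.Countable ∧ a.Infinite ∧ (∀ n β, ∃ z ∈ a, ∀ w ∈ a, w ∈ D n β → w < z) ∧
    ∃ δ, IsLUB a δ ∧ ∃ h : L → Om, StrictMonoOn h a ∧ ∀ x ∈ a, h x < s δ}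

theorem RegT.emb (R : RegT L) (A : Set L) (hA : aleph 1 ≤ #A) :
    ∃ g : Om → L, StrictMono g ∧ ∀ i, g i ∈ A := by
  have : WellFoundedLT L := ⟨R.wf⟩
  have h1 : Ordinal.type ((· < ·) : Om → Om → Prop) ≤ Ordinal.type ((· < ·) : A → A → Prop) := by
    rw [Ordinal.type_toType, ord_le]
    exact hA
  rw [Ordinal.type_le_iff'] at h1
  obtain ⟨f⟩ := h1
  exact ⟨fun i => (f i).1, fun i j h => f.map_rel_iff.2 h, fun i => (f i).2⟩

theorem nonrefl (R : RegT L) (D : ℕ → L → Set L) (s : L → Om)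
    (hD : ∀ β, ∀ x < β, ∃ n, x ∈ D n β) (A : Set L) (hA : aleph 1 ≤ #A) (hA2 : #A < #L) :
    ∃ c E : Set L, c ⊆ A ∧ c.Countable ∧ (∀ x ∈ A, ∃ y ∈ A, y ∈ E ∧ x ≤ y) ∧
      ∀ a ⊆ A, c ⊆ a → (∀ x ∈ a, ∃ y ∈ a, y ∈ E ∧ x ≤ y) → a ∉ Afam D s := by
  obtain ⟨β, hβ⟩ := R.bd A hA2
  by_cases hc : ∃ c ⊆ A, c.Countable ∧ ∀ x ∈ A, ∃ y ∈ c, x ≤ y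
  · obtain ⟨c, hcA, hcc, hcof⟩ := hc
    obtain ⟨δ, hδ⟩ := R.lub (fun x hx => (hβ x hx).le)
    obtain ⟨g, hg, hgA⟩ := R.emb A hA
    refine ⟨c ∪ g '' (Iic (s δ)), univ, ?_, ?_, ?_, ?_⟩
    · rintro x (hx | ⟨i, -, rfl⟩)
      · exact hcA hx
      · exact hgA i
    · refine hcc.union (Countable.image ?_ g)
      obtain ⟨j, hj⟩ := regOm.gt (s δ)
      exact (Om_seg j).mono (fun x hx => lt_of_le_of_lt hx hj)
    · intro x hx
      exact ⟨x, hx, trivial, le_rfl⟩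
    · rintro a haA hca - ⟨-, -, -, δ', hδ', h, hh, hs⟩
      have heq : δ' = δ := by
        refine hδ'.unique ⟨fun x hx => hδ.1 (haA hx), fun z hz => hδ.2 fun x hx => ?_⟩
        obtain ⟨y, hy, hxy⟩ := hcof x hx
        exact hxy.trans (hz (hca (Or.inl hy)))
      subst heq
      have key : ∀ i : Om, i ≤ s δ' → i ≤ h (g i) := by
        intro i
        induction i using regOm.wf.induction with
        | _ i ih =>
          intro hi
          by_contra hlt
          push Not at hlt
          have h1 := ih _ hlt (hlt.le.trans hi)
          have h2 : h (g (h (g i))) < h (g i) :=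
            hh (hca (Or.inr ⟨_, hlt.le.trans hi, rfl⟩)) (hca (Or.inr ⟨_, hi, rfl⟩)) (hg hlt)
          exact absurd h1 (not_le.2 h2)
      have := key _ le_rfl
      exact absurd this (not_le.2 (hs _ (hca (Or.inr ⟨_, le_refl (s δ'), rfl⟩))))
  · have : ∃ n, ∀ x ∈ A, ∃ y ∈ A, y ∈ D n β ∧ x ≤ y := by
      by_contra hcon
      push Not at hcon
      choose z hz hzD using hcon
      refine hc ⟨range z, ?_, countable_range z, fun x hx => ?_⟩
      · rintro _ ⟨n, rfl⟩
        exact hz n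
      · obtain ⟨n, hn⟩ := hD β x (hβ x hx)
        exact ⟨z n, ⟨n, rfl⟩, (hzD n x hx hn).le⟩
    obtain ⟨n, hn⟩ := this
    refine ⟨∅, D n β, empty_subset _, countable_empty, hn, ?_⟩
    rintro a - - hcl ⟨-, -, h, -⟩
    obtain ⟨z, hz, hzD⟩ := h n β
    obtain ⟨y, hy, hyD, hzy⟩ := hcl z hz
    exact absurd (hzD y hy hyD) (not_lt.2 hzy)

end

section

variable {L : Type} [LinearOrder L]

def pos {X : Type} (p : List X) (r : ℕ → X) : ℕ → List X
  | 0 => p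
  | k+1 => r k :: pos p r k

theorem pos_shift {X : Type} (p : List X) (r : ℕ → X) (k : ℕ) :
    pos (r 0 :: p) (fun n => r (n+1)) k = pos p r (k+1) := by
  induction k with
  | zero => rfl
  | succ k ih => simp only [pos] at ih ⊢; rw [ih]

theorem pos_len {X : Type} (r : ℕ → X) (k : ℕ) : (pos [] r k).length = k := by
  induction k with
  | zero => rfl
  | succ k ih => simp only [pos, List.length_cons, ih]

theorem pos_map {X Y : Type} (f : X → Y) (r : ℕ → X) (k : ℕ) :
    (pos [] r k).map f = pos [] (fun n => f (r n)) k := by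
  induction k with
  | zero => rfl
  | succ k ih => simp only [pos, List.map_cons, ih]

theorem pos_mem {X : Type} (r : ℕ → X) (k : ℕ) (z : X) (h : z ∈ pos [] r k) : ∃ i < k, z = r i := by
  induction k with
  | zero => simp [pos] at h
  | succ k ih =>
    simp only [pos, List.mem_cons] at h
    rcases h with h | h
    · exact ⟨k, Nat.lt_succ_self k, h⟩
    · obtain ⟨i, hi, rfl⟩ := ih h
      exact ⟨i, by omega, rfl⟩

theorem pos_suffix {X : Type} (r : ℕ → X) (k : ℕ) (q : List X) :
    q <:+ pos [] r k ↔ ∃ m ≤ k, q = pos [] r m := by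
  induction k with
  | zero => simp [pos]
  | succ k ih =>
    simp only [pos, List.suffix_cons_iff, ih]
    constructor
    · rintro (rfl | ⟨m, hm, rfl⟩)
      · exact ⟨k+1, le_rfl, rfl⟩
      · exact ⟨m, by omega, rfl⟩
    · rintro ⟨m, hm, rfl⟩
      rcases Nat.lt_or_ge m (k+1) with h | h
      · exact Or.inr ⟨m, by omega, rfl⟩
      · have : m = k+1 := by omega
        subst this
        exact Or.inl rfl

def Legal (κ : List L → ℕ → L) (φ : ℕ → ℕ → Om) (p : List (L × L)) : Prop :=
  (∀ u v q, u :: v :: q <:+ p → ∀ j, ¬ (v.2 ≤ κ (p.map Prod.fst) j ∧ κ (p.map Prod.fst) j < u.1)) ∧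
  ∀ q q', q <:+ p → q' <:+ p → ∀ j j', κ (q.map Prod.fst) j < κ (q'.map Prod.fst) j' →
    φ q.length j < φ q'.length j'

inductive Lose (κ : List L → ℕ → L) (φ : ℕ → ℕ → Om) : List (L × L) → Prop
  | ill (p) : ¬ Legal κ φ p → Lose κ φ p
  | step (p) (ζ : L) : (∀ u : L × L, ζ < u.1 → Lose κ φ (u :: p)) → Lose κ φ p

theorem Lose.strat [Nonempty L] {κ : List L → ℕ → L} {φ : ℕ → ℕ → Om} {p : List (L × L)}
    (h : Lose κ φ p) :
    ∃ σ : List (L × L) → L, ∀ r : ℕ → L × L, (∀ k, σ ((List.range k).map r) < (r k).1) →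
      ∃ k, ¬ Legal κ φ (pos p r k) := by
  classical
  induction h with
  | ill p hp => exact ⟨fun _ => Classical.arbitrary _, fun r _ => ⟨0, hp⟩⟩
  | step p ζ _ ih =>
    choose σ hσ using ih
    refine ⟨fun l => match l with
      | [] => ζ
      | u :: l => if hu : ζ < u.1 then σ u hu l else Classical.arbitrary _, fun r hr => ?_⟩
    have h0 : ζ < (r 0).1 := by simpa using hr 0
    obtain ⟨k, hk⟩ := hσ (r 0) h0 (fun n => r (n+1)) (fun k => by
      have h1 := hr (k+1)
      rw [List.range_succ_eq_map] at h1
      simp only [List.map_cons, List.map_map, h0, dif_pos] at h1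
      exact h1)
    rw [pos_shift] at hk
    exact ⟨k+1, hk⟩

theorem RegT.list_lt (R : RegT L) (X : Type) (hX : #X < #L) : #(List X) < #L :=
  (mk_list_le_max X).trans_lt (max_lt R.unc hX)

theorem RegT.prod_lt (R : RegT L) {X Y : Type} (hX : #X < #L) (hY : #Y < #L) : #(X × Y) < #L := by
  rw [mk_prod, lift_id, lift_id]
  exact mul_lt_of_lt R.unc.le hX hY

def toSub (x : L) (l : List (L × L)) (h : ∀ u ∈ l, u.1 ≤ x ∧ u.2 ≤ x) : List (Iic x × Iic x) :=
  l.attach.map (fun u => (⟨u.1.1, (h u.1 u.2).1⟩, ⟨u.1.2, (h u.1 u.2).2⟩))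

theorem toSub_eq (x : L) (l : List (L × L)) (h : ∀ u ∈ l, u.1 ≤ x ∧ u.2 ≤ x) :
    (toSub x l h).map (fun v => (v.1.1, v.2.1)) = l := by
  rw [toSub, List.map_map]
  exact List.attach_map_subtype_val l

theorem game (R : RegT L) (h1 : aleph 1 < #L) (hφ : #(ℕ → ℕ → Om) < #L) (κ : List L → ℕ → L) :
    ∃ (φ : ℕ → ℕ → Om) (W : Set (List (L × L))), [] ∈ W ∧ (∀ p ∈ W, Legal κ φ p) ∧
      ∀ p ∈ W, ∀ ζ, ∃ u : L × L, ζ < u.1 ∧ u :: p ∈ W := by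
  have := R.inf
  by_cases hc : ∃ φ, ¬ Lose κ φ []
  · obtain ⟨φ, hφ⟩ := hc
    refine ⟨φ, {p | ¬ Lose κ φ p}, hφ, ?_, ?_⟩
    · intro p hp
      by_contra h
      exact hp (Lose.ill p h)
    · intro p hp ζ
      by_contra h
      push Not at h
      exact hp (Lose.step p ζ fun u hu => not_not.1 (h u hu))
  exfalso
  push Not at hc
  choose σ hσ using fun φ => (hc φ).strat
  have hF : ∀ x : L, ∃ b : L, ∀ i : (ℕ → ℕ → Om) × List (Iic x × Iic x),
      σ i.1 (i.2.map (fun v => (v.1.1, v.2.1))) < b := fun x =>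
    R.bdr (R.prod_lt hφ (R.list_lt _ (R.prod_lt (R.segc x) (R.segc x)))) _
  choose F hF using hF
  choose Y hY1 hY2 hY3 using R.om1_pt h1 F
  let x0 : L := Classical.arbitrary _
  let y : ℕ → L := fun n => Y^[n+1] x0
  have hy : ∀ n, y (n+1) = Y (y n) := fun n => Function.iterate_succ_apply' Y (n+1) x0
  have hym : StrictMono y := strictMono_nat_of_lt_succ (fun n => by rw [hy]; exact hY1 _)
  have hyY : ∀ n, ∃ x, y n = Y x := by
    intro n
    cases n with
    | zero => exact ⟨x0, rfl⟩
    | succ n => exact ⟨y n, hy n⟩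
  let a : Set L := ⋃ k, range (κ (pos [] y k))
  have hac : a.Countable := countable_iUnion fun k => countable_range _
  have hb : ∀ k, ∃ b < y (k+1), ∀ w ∈ a, w < y (k+1) → w < b := by
    intro k
    obtain ⟨z, hz, hz2⟩ := hY3 (y k) (a ∩ Iio (y (k+1))) (hac.mono inter_subset_left)
      (fun x hx => by rw [← hy]; exact hx.2)
    exact ⟨z, by rw [hy]; exact hz, fun w hw hwy => hz2 w ⟨hw, hwy⟩⟩
  choose b hb1 hb2 using hb
  obtain ⟨h, hh⟩ := R.rank a hac
  let φ : ℕ → ℕ → Om := fun m j => h (κ (pos [] y m) j)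
  have hmema : ∀ k j, κ (pos [] y k) j ∈ a := fun k j => mem_iUnion.2 ⟨k, j, rfl⟩
  let r : ℕ → L × L := fun k => (y k, b k)
  obtain ⟨k, hk⟩ := hσ φ r (by
    intro k
    obtain ⟨x, hx⟩ := hyY k
    have hlist : ∀ u ∈ (List.range k).map r, u.1 < y k ∧ u.2 < y k := by
      intro u hu
      rw [List.mem_map] at hu
      obtain ⟨i, hi, rfl⟩ := hu
      rw [List.mem_range] at hi
      exact ⟨hym hi, (hb1 i).trans_le (hym.monotone hi)⟩
    obtain ⟨z, hz, hz2⟩ := hY3 x ({w | ∃ u ∈ (List.range k).map r, w = u.1 ∨ w = u.2}) (by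
      have hfin : ({w | ∃ u ∈ (List.range k).map r, w = u.1 ∨ w = u.2} : Set L).Finite := by
        have h3 : {u | u ∈ (List.range k).map r}.Finite := List.finite_toSet _
        refine ((h3.image Prod.fst).union (h3.image Prod.snd)).subset ?_
        rintro w ⟨u, hu, rfl | rfl⟩
        · exact Or.inl ⟨u, hu, rfl⟩
        · exact Or.inr ⟨u, hu, rfl⟩
      exact hfin.countable) (by
      rintro w ⟨u, hu, rfl | rfl⟩
      · rw [← hx]; exact (hlist u hu).1
      · rw [← hx]; exact (hlist u hu).2)
    have h4 := hF z (φ, toSub z ((List.range k).map r) (fun u hu =>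
      ⟨(hz2 _ ⟨u, hu, Or.inl rfl⟩).le, (hz2 _ ⟨u, hu, Or.inr rfl⟩).le⟩))
    rw [toSub_eq] at h4
    have h5 := hY2 x z hz
    rw [← hx] at h5
    exact h4.trans h5)
  apply hk
  have hpm : ∀ m, (pos [] r m).map Prod.fst = pos [] y m := fun m => pos_map _ _ _
  refine ⟨?_, ?_⟩
  · rintro u v q hs j ⟨hv, hu⟩
    obtain ⟨m, hm, he⟩ := (pos_suffix r k _).1 hs
    rw [hpm] at hv hu
    match m, he with
    | 0, he => simp [pos] at he
    | 1, he => simp [pos] at he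
    | m+2, he =>
      simp only [pos, List.cons.injEq] at he
      obtain ⟨rfl, rfl, -⟩ := he
      exact absurd (hb2 m _ (hmema k j) hu) (not_lt.2 hv)
  · intro q q' hq hq' j j' hlt
    obtain ⟨m, hm, rfl⟩ := (pos_suffix r k _).1 hq
    obtain ⟨m', hm', rfl⟩ := (pos_suffix r k _).1 hq'
    rw [hpm, hpm] at hlt
    rw [pos_len, pos_len]
    exact hh (hmema _ _) (hmema _ _) hlt

end

section

variable {L : Type} [LinearOrder L]

theorem picks (R : RegT L) (M : Type) (hML : #M < #L) (W : Set (List (L × L)))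
    (hW : ∀ p ∈ W, ∀ ζ, ∃ u : L × L, ζ < u.1 ∧ u :: p ∈ W) :
    ∃ (pk : W → L → M → L × L) (ρ : L → Set M), (∀ p ζ ξ, ζ < (pk p ζ ξ).1 ∧ pk p ζ ξ :: p.1 ∈ W) ∧
      (∀ z, (ρ z).Subsingleton) ∧
      ∀ p ζ ξ z, (pk p ζ ξ).1 ≤ z → z < (pk p ζ ξ).2 → ξ ∈ ρ z := by
  classical
  have := R.inf
  obtain ⟨ν⟩ : Nonempty (W × L × M ↪ L) := by
    have h1 : #(List (L × L)) ≤ #L := by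
      refine (mk_list_le_max _).trans (max_le R.unc.le ?_)
      simp [mul_eq_self R.unc.le]
    have h2 : #(W × L × M) ≤ #L := by
      simp only [mk_prod, lift_id]
      calc #W * (#L * #M) ≤ #L * (#L * #L) :=
            mul_le_mul' ((mk_set_le W).trans h1) (mul_le_mul' le_rfl hML.le)
        _ = #L := by rw [mul_eq_self R.unc.le, mul_eq_self R.unc.le]
    exact h2
  have hwf : WellFounded (InvImage ((· < ·) : L → L → Prop) ν) := InvImage.wf ν R.wf
  have hstep : ∀ (t : W × L × M) (f : ∀ t', ν t' < ν t → L × L), ∃ u : L × L, t.2.1 < u.1 ∧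
      u :: t.1.1 ∈ W ∧ ∀ t' ht', (f t' ht').2 < u.1 := by
    intro t f
    obtain ⟨b, hb⟩ := R.bd {z | ∃ t' ht', z = (f t' ht').2} (by
      refine lt_of_le_of_lt ?_ (R.seg (ν t))
      let g : {t' // ν t' < ν t} → L := fun t' => (f t'.1 t'.2).2
      have h3 : {z | ∃ t' ht', z = (f t' ht').2} ⊆ range g := by
        rintro z ⟨t', ht', rfl⟩
        exact ⟨⟨t', ht'⟩, rfl⟩
      refine (mk_le_mk_of_subset h3).trans (mk_range_le.trans ?_)
      refine mk_le_of_injective (f := fun t' => (⟨ν t'.1, t'.2⟩ : Iio (ν t))) ?_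
      intro s s' hs
      exact Subtype.ext (ν.injective (congrArg Subtype.val hs)))
    obtain ⟨u, hu, huW⟩ := hW t.1.1 t.1.2 (max t.2.1 b)
    exact ⟨u, (le_max_left _ _).trans_lt hu, huW, fun t' ht' =>
      (hb _ ⟨t', ht', rfl⟩).trans ((le_max_right _ _).trans_lt hu)⟩
  choose S hS1 hS2 hS3 using hstep
  let g : W × L × M → L × L := hwf.fix S
  have hg : ∀ t, g t = S t (fun t' _ => g t') := fun t => hwf.fix_eq S t
  have hdis : ∀ t t', ν t' < ν t → (g t').2 < (g t).1 := fun t t' h => by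
    rw [hg t]; exact hS3 t (fun t' _ => g t') t' h
  have huniq : ∀ t t' z, (g t).1 ≤ z → z < (g t).2 → (g t').1 ≤ z → z < (g t').2 → t = t' := by
    intro t t' z h1 h2 h3 h4
    apply ν.injective
    rcases lt_trichotomy (ν t) (ν t') with h | h | h
    · exact absurd (h2.trans ((hdis _ _ h).trans_le h3)) (lt_irrefl _)
    · exact h
    · exact absurd (h4.trans ((hdis _ _ h).trans_le h1)) (lt_irrefl _)
  refine ⟨fun p ζ ξ => g (p, ζ, ξ), fun z => {ξ | ∃ p ζ, (g (p, ζ, ξ)).1 ≤ z ∧ z < (g (p, ζ, ξ)).2},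
    ?_, ?_, ?_⟩
  · intro p ζ ξ
    beta_reduce
    rw [hg]
    exact ⟨hS1 (p, ζ, ξ) _, hS2 (p, ζ, ξ) _⟩
  · rintro z ξ ⟨p, ζ, h1, h2⟩ ξ' ⟨p', ζ', h3, h4⟩
    have := huniq _ _ z h1 h2 h3 h4
    simp only [Prod.mk.injEq] at this
    exact this.2.2
  · intro p ζ ξ z h1 h2
    exact ⟨p, ζ, h1, h2⟩

theorem OmL.list {d : ℕ → L} {δ : L} (h : OmL d δ) (l : List (L × L))
    (hl : ∀ u ∈ l, u.1 < δ ∧ u.2 < δ) : ∃ n, ∀ u ∈ l, u.1 ≤ d n ∧ u.2 ≤ d n := by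
  induction l with
  | nil => exact ⟨0, by simp⟩
  | cons v l ih =>
    obtain ⟨n, hn⟩ := ih (fun u hu => hl u (List.mem_cons_of_mem _ hu))
    obtain ⟨n1, hn1⟩ := h.ex (hl v List.mem_cons_self).1
    obtain ⟨n2, hn2⟩ := h.ex (hl v List.mem_cons_self).2
    refine ⟨max n (max n1 n2), ?_⟩
    have m0 : d n ≤ d (max n (max n1 n2)) := h.1.monotone (by omega)
    have m1 : d n1 ≤ d (max n (max n1 n2)) := h.1.monotone (by omega)
    have m2 : d n2 ≤ d (max n (max n1 n2)) := h.1.monotone (by omega)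
    intro u hu
    rw [List.mem_cons] at hu
    rcases hu with rfl | hu
    · exact ⟨hn1.le.trans m1, hn2.le.trans m2⟩
    · exact ⟨(hn u hu).1.trans m0, (hn u hu).2.trans m0⟩

theorem stat (R : RegT L) (h1 : aleph 1 < #L) (hφ : #(ℕ → ℕ → Om) < #L) (M : Type) (hML : #M < #L)
    (D : ℕ → L → Set L) (s : L → Om)
    (hs : ∀ (i : Om) (F : L → L), ∃ (δ : L) (d : ℕ → L), OmL d δ ∧ i ≤ s δ ∧ ∀ x < δ, F x < δ)
    (hesc : ∀ ρ : L → Set M, (∀ z, (ρ z).Subsingleton) →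
      ∃ x : ℕ → M, ∀ n β, {k | ∃ z ∈ D n β, x k ∈ ρ z}.Finite)
    (κ : List L → ℕ → L) (hκ : ∀ l η, range (κ l) ⊆ range (κ (η :: l)))
    (hκ2 : ∀ l η, η ∈ range (κ (η :: l))) :
    ∃ y : ℕ → L, (⋃ k, range (κ (pos [] y k))) ∈ Afam D s := by
  classical
  obtain ⟨φ, W, hW0, hWl, hWe⟩ := game R h1 hφ κ
  obtain ⟨i0, hi0⟩ := regOm.bdc (S := range (fun m : ℕ × ℕ => φ m.1 m.2)) (countable_range _)
  obtain ⟨pk, ρ, hpk, hρ, hpkρ⟩ := picks R M hML W hWe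
  obtain ⟨x, hx⟩ := hesc ρ hρ
  have hF : ∀ x : L, ∃ b : L, ∀ i : List (Iic x × Iic x) × Iic x × M × ℕ,
      (∀ h : i.1.map (fun v => (v.1.1, v.2.1)) ∈ W,
        (pk ⟨_, h⟩ i.2.1.1 i.2.2.1).1 < b ∧ (pk ⟨_, h⟩ i.2.1.1 i.2.2.1).2 < b) ∧
      κ ((i.1.map (fun v => (v.1.1, v.2.1))).map Prod.fst) i.2.2.2 < b := by
    intro x
    have hcard : #(List (Iic x × Iic x) × Iic x × M × ℕ) < #L :=
      R.prod_lt (R.list_lt _ (R.prod_lt (R.segc x) (R.segc x))) (R.prod_lt (R.segc x)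
        (R.prod_lt hML (by simpa using R.unc)))
    obtain ⟨b1, hb1⟩ := R.bdr hcard (fun i => if h : i.1.map (fun v => (v.1.1, v.2.1)) ∈ W then
      max (pk ⟨_, h⟩ i.2.1.1 i.2.2.1).1 (pk ⟨_, h⟩ i.2.1.1 i.2.2.1).2 else x)
    obtain ⟨b2, hb2⟩ := R.bdr hcard
      (fun i => κ ((i.1.map (fun v => (v.1.1, v.2.1))).map Prod.fst) i.2.2.2)
    refine ⟨max b1 b2, fun i => ⟨fun h => ?_, (hb2 i).trans_le (le_max_right _ _)⟩⟩
    have := hb1 i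
    rw [dif_pos h] at this
    exact ⟨(le_max_left _ _).trans_lt (this.trans_le (le_max_left _ _)),
      (le_max_right _ _).trans_lt (this.trans_le (le_max_left _ _))⟩
  choose F hF using hF
  obtain ⟨δ, d, ho, hsδ, hcl⟩ := hs i0 F
  let P : ℕ → W := fun n => Nat.rec (motive := fun _ => W) ⟨[], hW0⟩
    (fun k p => ⟨pk p (d k) (x k) :: p.1, (hpk p (d k) (x k)).2⟩) n
  let r : ℕ → L × L := fun k => pk (P k) (d k) (x k)
  have hP : ∀ k, (P k).1 = pos [] r k := by
    intro k
    induction k with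
    | zero => rfl
    | succ k ih =>
      show r k :: (P k).1 = _
      rw [ih]; rfl
  let y : ℕ → L := fun k => (r k).1
  have hPm : ∀ k, (P k).1.map Prod.fst = pos [] y k := fun k => by rw [hP, pos_map]
  have hbelow : ∀ k, ∀ u ∈ (P k).1, u.1 < δ ∧ u.2 < δ := by
    intro k
    induction k with
    | zero => intro u hu; exact absurd hu (by simp [hP, pos])
    | succ k ih =>
      intro u hu
      have hu' : u ∈ r k :: (P k).1 := hu
      rw [List.mem_cons] at hu'
      rcases hu' with rfl | hu'
      · obtain ⟨n, hn⟩ := ho.list _ ih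
        have hn' : ∀ u ∈ (P k).1, u.1 ≤ d (max n k) ∧ u.2 ≤ d (max n k) := fun u hu =>
          ⟨(hn u hu).1.trans (ho.1.monotone (le_max_left _ _)),
           (hn u hu).2.trans (ho.1.monotone (le_max_left _ _))⟩
        have hdk : d k ≤ d (max n k) := ho.1.monotone (le_max_right _ _)
        have h3 := (hF (d (max n k)) (toSub _ (P k).1 hn', ⟨d k, hdk⟩, x k, 0)).1
        simp only [toSub_eq] at h3
        have h4 := h3 (P k).2
        have h5 := hcl _ (ho.lt (max n k))
        exact ⟨h4.1.trans h5, h4.2.trans h5⟩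
      · exact ih u hu'
  have hrδ : ∀ k, (r k).1 < δ ∧ (r k).2 < δ := fun k => hbelow (k+1) (r k) (by
    show r k ∈ r k :: (P k).1
    exact List.mem_cons_self)
  have hκδ : ∀ k j, κ (pos [] y k) j < δ := by
    intro k j
    obtain ⟨n, hn⟩ := ho.list _ (hbelow k)
    have h3 := (hF (d n) (toSub _ (P k).1 hn, ⟨d n, le_refl (d n)⟩, x k, j)).2
    simp only [toSub_eq, hPm] at h3
    exact h3.trans (hcl _ (ho.lt n))
  have hyd : ∀ k, d k < y k := fun k => (hpk _ _ _).1
  set a : Set L := ⋃ k, range (κ (pos [] y k)) with ha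
  have hmono : ∀ m k, m ≤ k → range (κ (pos [] y m)) ⊆ range (κ (pos [] y k)) := by
    intro m k hmk
    induction k, hmk using Nat.le_induction with
    | base => exact subset_rfl
    | succ k _ ih => exact ih.trans (hκ _ _)
  have hya : ∀ k, y k ∈ a := fun k => mem_iUnion.2 ⟨k+1, hκ2 _ _⟩
  have haδ : ∀ z ∈ a, z < δ := by
    intro z hz
    obtain ⟨k, j, rfl⟩ := mem_iUnion.1 hz
    exact hκδ k j
  have hcof : ∀ z < δ, ∃ k, z < y k := fun z hz => by
    obtain ⟨k, hk⟩ := ho.ex hz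
    exact ⟨k, hk.trans (hyd k)⟩
  have hint : ∀ z ∈ a, y 0 ≤ z → ∃ k, y k ≤ z ∧ z < (r k).2 := by
    intro z hz h0
    have hex := hcof z (haδ z hz)
    have hf := Nat.find_spec hex
    have hmin := fun m => Nat.find_min hex (m := m)
    obtain ⟨k, hk⟩ : ∃ k, Nat.find hex = k+1 := by
      refine Nat.exists_eq_succ_of_ne_zero fun h => ?_
      rw [h] at hf
      exact absurd hf (not_lt.2 h0)
    rw [hk] at hf hmin
    have hk' : y k ≤ z := not_lt.1 (hmin k (Nat.lt_succ_self k))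
    refine ⟨k, hk', ?_⟩
    by_contra hcon
    push Not at hcon
    obtain ⟨m, hm⟩ := mem_iUnion.1 hz
    obtain ⟨j, hj⟩ := hmono m (max m (k+2)) (le_max_left _ _) hm
    have hlg := (hWl _ (P (max m (k+2))).2).1 (r (k+1)) (r k) (pos [] r k) (by
      rw [hP, pos_suffix]
      exact ⟨k+2, le_max_right _ _, rfl⟩) j
    rw [hPm, hj] at hlg
    exact hlg ⟨hcon, hf⟩
  have hne : a.Nonempty := ⟨y 0, hya 0⟩
  refine ⟨y, countable_iUnion fun k => countable_range _, ?_, ?_, δ, ⟨fun z hz => (haδ z hz).le, ?_⟩, ?_⟩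
  · intro hfin
    obtain ⟨z, hz, hmax⟩ := hfin.exists_maximalFor id a hne
    obtain ⟨k, hk⟩ := hcof z (haδ z hz)
    exact absurd (hmax (hya k) hk.le) (not_le.2 hk)
  · intro n β
    obtain ⟨N, hN⟩ := (hx n β).bddAbove
    -- bound
    have hB : ∃ B < δ, y 0 ≤ B ∧ ∀ k ≤ N, (r k).2 ≤ B := by
      have : ∀ N : ℕ, ∃ B < δ, y 0 ≤ B ∧ ∀ k < N, (r k).2 ≤ B := by
        intro N
        induction N with
        | zero => exact ⟨y 0, (hrδ 0).1, le_rfl, fun k hk => absurd hk (by omega)⟩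
        | succ N ih =>
          obtain ⟨B, hB, hB0, hB1⟩ := ih
          refine ⟨max B (r N).2, max_lt hB (hrδ N).2, hB0.trans (le_max_left _ _), fun k hk => ?_⟩
          rcases Nat.lt_succ_iff_lt_or_eq.1 hk with h | rfl
          · exact (hB1 k h).trans (le_max_left _ _)
          · exact le_max_right _ _
      obtain ⟨B, hB⟩ := this (N+1)
      exact ⟨B, hB.1, hB.2.1, fun k hk => hB.2.2 k (by omega)⟩
    obtain ⟨B, hB, hB0, hB1⟩ := hB
    obtain ⟨k, hk⟩ := hcof B hB
    refine ⟨y k, hya k, fun w hw hwD => ?_⟩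
    by_contra hcon
    push Not at hcon
    have hBw : B < w := hk.trans_le hcon
    obtain ⟨m, hm1, hm2⟩ := hint w hw (hB0.trans hBw.le)
    have hmN : m ≤ N := hN ⟨w, hwD, hpkρ _ _ _ w hm1 hm2⟩
    exact absurd (hm2.trans_le (hB1 m hmN)) (not_lt.2 hBw.le)
  · intro z hz
    by_contra hcon
    push Not at hcon
    obtain ⟨k, hk⟩ := hcof z hcon
    exact absurd (hz (hya k)) (not_le.2 hk)
  · have : ∀ z, ∃ v : Om, z ∈ a → ∃ m j, κ (pos [] y m) j = z ∧ φ m j = v := by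
      intro z
      by_cases hz : z ∈ a
      · obtain ⟨m, j, h⟩ := mem_iUnion.1 hz
        exact ⟨φ m j, fun _ => ⟨m, j, h, rfl⟩⟩
      · exact ⟨i0, fun h => absurd h hz⟩
    choose h hh using this
    refine ⟨h, ?_, ?_⟩
    · intro z hz z' hz' hlt
      obtain ⟨m, j, hm, hv⟩ := hh z hz
      obtain ⟨m', j', hm', hv'⟩ := hh z' hz'
      have hlg := (hWl _ (P (max m m')).2).2 (pos [] r m) (pos [] r m') (by
        rw [hP, pos_suffix]; exact ⟨m, le_max_left _ _, rfl⟩) (by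
        rw [hP, pos_suffix]; exact ⟨m', le_max_right _ _, rfl⟩) j j'
      rw [← hP, ← hP, hPm, hPm, hP, hP, pos_len, pos_len, hm, hm', hv, hv'] at hlg
      exact hlg hlt
    · intro z hz
      obtain ⟨m, j, hm, hv⟩ := hh z hz
      rw [← hv]
      exact (hi0 _ ⟨(m, j), rfl⟩).trans_le hsδ

end

section

theorem main1
    (hrefl : ∀ lam : Cardinal.{0}, Cardinal.aleph 1 < lam →
      ∀ 𝒜 : Set (Set Ordinal.{0}), 𝒜 ⊆ ctblInf (Set.Iio lam.ord) →
        StatFam (Set.Iio lam.ord) 𝒜 →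
        ∃ A : Set Ordinal.{0}, A ⊆ Set.Iio lam.ord ∧
          #A = Cardinal.aleph 1 ∧ Reflects 𝒜 A)
    (M : Type) (hM : ℵ₀ ≤ #M) (Mn : ℕ → Set M) (hMn : ∀ x, ∃ n, x ∈ Mn n)
    (hMc : ∀ n, #(Mn n) < #M) (hp : ∀ ν < #M, ν ^ ℵ₀ < #M) : #M ^ ℵ₀ ≤ Order.succ #M := by
  classical
  by_contra hcon
  push Not at hcon
  set lam : Cardinal.{0} := Order.succ #M with hlam
  have hreg : lam.IsRegular := isRegular_succ hM
  have hMlam : #M < lam := Order.lt_succ _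
  let L : Type := lam.ord.ToType
  have hL : #L = lam := by simp [L]
  have hML : #M < #L := by rw [hL]; exact hMlam
  have R : RegT L := RegT.of_reg hreg (hM.trans_lt hMlam)
  have hne := R.inf
  have : Infinite M := Cardinal.infinite_iff.2 hM
  have hom : aleph 1 < #M := by
    refine aleph_one_le_continuum.trans_lt ?_
    rw [← two_power_aleph0]
    exact hp 2 (lt_of_lt_of_le (by exact_mod_cast natCast_lt_aleph0 (n := 2)) hM)
  have h1 : aleph 1 < #L := hom.trans hML
  have hφ : #(ℕ → ℕ → Om) < #L := by
    refine lt_of_le_of_lt ?_ ((hp _ (hp _ hom)).trans hML)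
    simp
  -- the matrix
  have he : ∀ β : L, ∃ e : Iio β → M, Function.Injective e := by
    intro β
    have h := (R.seg β).trans_eq (hL.trans hlam)
    obtain ⟨f⟩ := Order.lt_succ_iff.1 h
    exact ⟨f, f.injective⟩
  choose e he using he
  let D : ℕ → L → Set L := fun n β => {x | ∃ h : x < β, e β ⟨x, h⟩ ∈ Mn n}
  have hD : ∀ β, ∀ x < β, ∃ n, x ∈ D n β := fun β x h => by
    obtain ⟨n, hn⟩ := hMn (e β ⟨x, h⟩)
    exact ⟨n, h, hn⟩
  have hDc : ∀ n β, #(D n β) < #M := by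
    intro n β
    refine lt_of_le_of_lt ?_ (hMc n)
    refine mk_le_of_injective (f := fun x : D n β => (⟨e β ⟨x.1, x.2.1⟩, x.2.2⟩ : Mn n)) ?_
    intro x y hxy
    have h2 := he β (congrArg Subtype.val hxy)
    exact Subtype.ext (Subtype.mk.inj h2)
  obtain ⟨s, hs⟩ := R.ulam M hM hL
  have hesc : ∀ ρ : L → Set M, (∀ z, (ρ z).Subsingleton) →
      ∃ x : ℕ → M, ∀ n β, {k | ∃ z ∈ D n β, x k ∈ ρ z}.Finite := by
    intro ρ hρ
    obtain ⟨x, hx⟩ := escape M hM hp lam hMlam.le hcon (ι := ℕ × L) (by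
      rw [mk_prod, lift_id, lift_id, hL, mk_nat]
      exact (aleph0_mul_eq (hM.trans hMlam.le)).le)
      (fun i => {m | ∃ z ∈ D i.1 i.2, m ∈ ρ z}) (by
      rintro ⟨n, β⟩
      refine lt_of_le_of_lt ?_ (hDc n β)
      have hch : ∀ m : {m | ∃ z ∈ D n β, m ∈ ρ z}, ∃ z : D n β, m.1 ∈ ρ z.1 := by
        rintro ⟨m, z, hz, hm⟩
        exact ⟨⟨z, hz⟩, hm⟩
      choose f hf using hch
      refine mk_le_of_injective (f := f) ?_
      intro m m' hmm
      apply Subtype.ext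
      apply hρ (f m).1 (hf m)
      rw [hmm]
      exact hf m')
    exact ⟨x, fun n β => hx (n, β)⟩
  -- transfer
  let τ : L → Ordinal.{0} := fun x => ((Ordinal.ToType.mk (o := lam.ord)).symm x).1
  have hτ : StrictMono τ := fun x y hxy => (Ordinal.ToType.mk (o := lam.ord)).symm.strictMono hxy
  have hτI : ∀ x, τ x < lam.ord := fun x => ((Ordinal.ToType.mk (o := lam.ord)).symm x).2
  have hτs : ∀ o < lam.ord, ∃ x, τ x = o := fun o ho =>
    ⟨Ordinal.ToType.mk (o := lam.ord) ⟨o, ho⟩, by simp [τ]⟩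
  let 𝒜 : Set (Set Ordinal.{0}) := {b | ∃ a ∈ Afam D s, b = τ '' a}
  have h𝒜 : 𝒜 ⊆ ctblInf (Iio lam.ord) := by
    rintro b ⟨a, ha, rfl⟩
    refine ⟨?_, ha.1.image τ, ha.2.1.image hτ.injective.injOn⟩
    rintro _ ⟨x, -, rfl⟩
    exact hτI x
  have hstat : StatFam (Iio lam.ord) 𝒜 := by
    refine ⟨fun b hb => ⟨(h𝒜 hb).1, (h𝒜 hb).2.1⟩, ?_⟩
    intro 𝒞 h𝒞
    obtain ⟨hC1, hC2, hC3⟩ := h𝒞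
    have hex : ∀ (c : Set Ordinal.{0}) (η : L), ∃ c' : Set Ordinal.{0}, c ∈ small (Iio lam.ord) →
        c' ∈ 𝒞 ∧ c ⊆ c' ∧ τ η ∈ c' := by
      intro c η
      by_cases hc : c ∈ small (Iio lam.ord)
      · obtain ⟨c', h1, h2⟩ := hC3 (insert (τ η) c) ⟨by
          rintro x (rfl | hx)
          · exact hτI η
          · exact hc.1 hx, hc.2.insert _⟩
        exact ⟨c', fun _ => ⟨h1, (subset_insert _ _).trans h2, h2 (mem_insert _ _)⟩⟩
      · exact ⟨∅, fun h => absurd h hc⟩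
    choose N hN using hex
    let K : List L → Set Ordinal.{0} := fun l =>
      l.foldr (fun η c => N c η) (N ∅ (Classical.arbitrary L))
    have hK0 : K [] = N ∅ (Classical.arbitrary L) := rfl
    have hKs : ∀ η l, K (η :: l) = N (K l) η := fun η l => rfl
    have hK𝒞 : ∀ l, K l ∈ 𝒞 := by
      intro l
      induction l with
      | nil => rw [hK0]; exact (hN _ _ ⟨empty_subset _, countable_empty⟩).1
      | cons η l ih => rw [hKs]; exact (hN _ _ (hC1 ih)).1
    have hKm : ∀ η l, K l ⊆ K (η :: l) := fun η l => by
      rw [hKs]; exact (hN _ _ (hC1 (hK𝒞 l))).2.1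
    have hKη : ∀ η l, τ η ∈ K (η :: l) := fun η l => by
      rw [hKs]; exact (hN _ _ (hC1 (hK𝒞 l))).2.2
    have hKne : ∀ l, (τ ⁻¹' K l).Nonempty := by
      intro l
      cases l with
      | nil => exact ⟨_, (hN _ _ ⟨empty_subset _, countable_empty⟩).2.2⟩
      | cons η l => exact ⟨η, hKη η l⟩
    have hκ : ∀ l, ∃ f : ℕ → L, τ ⁻¹' K l = range f := fun l =>
      ((hC1 (hK𝒞 l)).2.preimage hτ.injective).exists_eq_range (hKne l)
    choose κ hκ using hκ
    have hκ' : ∀ l, τ '' range (κ l) = K l := by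
      intro l
      rw [← hκ, image_preimage_eq_iff]
      intro o ho
      obtain ⟨x, rfl⟩ := hτs o ((hC1 (hK𝒞 l)).1 ho)
      exact ⟨x, rfl⟩
    obtain ⟨y, hy⟩ := stat R h1 hφ M hML D s hs hesc κ
      (fun l η => by rw [← hκ, ← hκ]; exact preimage_mono (hKm η l))
      (fun l η => by rw [← hκ]; exact hKη η l)
    refine ⟨_, ⟨_, hy, rfl⟩, ?_⟩
    have hmono : ∀ m k, m ≤ k → K (pos [] y m) ⊆ K (pos [] y k) := by
      intro m k hmk
      induction k, hmk using Nat.le_induction with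
      | base => exact subset_rfl
      | succ k _ ih => exact ih.trans (hKm _ _)
    have := hC2 (range fun k => K (pos [] y k)) (by
      rintro _ ⟨k, rfl⟩
      exact hK𝒞 _) (range_nonempty _) (by
      rintro _ ⟨k, rfl⟩ _ ⟨m, rfl⟩ -
      rcases le_total k m with h | h
      · exact Or.inl (hmono _ _ h)
      · exact Or.inr (hmono _ _ h)) (countable_range _)
    rw [image_iUnion]
    simp only [hκ']
    rwa [sUnion_range] at this
  obtain ⟨A, hAI, hAc, hAr⟩ := hrefl lam (by rw [← hL]; exact h1) 𝒜 h𝒜 hstat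
  have hAeq : τ '' (τ ⁻¹' A) = A := by
    rw [image_preimage_eq_iff]
    intro o ho
    obtain ⟨x, rfl⟩ := hτs o (hAI ho)
    exact ⟨x, rfl⟩
  have hAc' : #(τ ⁻¹' A) = aleph 1 := by
    have h2 := mk_image_eq_lift τ (τ ⁻¹' A) hτ.injective
    rw [hAeq, hAc] at h2
    simp only [lift_aleph, Ordinal.lift_one] at h2
    apply lift_injective.{1}
    rw [← h2]
    simp
  obtain ⟨c, E, hcA, hcc, hE, hbad⟩ := nonrefl R D s hD (τ ⁻¹' A) hAc'.ge (by rw [hAc']; exact h1)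
  obtain ⟨b, ⟨⟨a, ha, rfl⟩, hb2⟩, hbA, -, hcb, hEb⟩ := hAr.2
    {b | b ⊆ A ∧ b.Countable ∧ τ '' c ⊆ b ∧ ∀ x ∈ b, ∃ y ∈ b, y ∈ τ '' E ∧ x ≤ y} (by
    refine ⟨fun b hb => ⟨hb.1, hb.2.1⟩, ?_, ?_⟩
    · intro 𝒟 hD1 hD2 hD3 hD4
      refine ⟨sUnion_subset fun b hb => (hD1 hb).1, hD4.sUnion fun b hb => (hD1 hb).2.1, ?_, ?_⟩
      · obtain ⟨b, hb⟩ := hD2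
        exact (hD1 hb).2.2.1.trans (subset_sUnion_of_mem hb)
      · rintro x ⟨b, hb, hx⟩
        obtain ⟨y, hy, h⟩ := (hD1 hb).2.2.2 x hx
        exact ⟨y, ⟨b, hb, hy⟩, h⟩
    · intro b hb
      have hf : ∀ x : Ordinal.{0}, ∃ y, x ∈ A → y ∈ A ∧ y ∈ τ '' E ∧ x ≤ y := by
        intro x
        by_cases hx : x ∈ A
        · rw [← hAeq] at hx
          obtain ⟨x, hx, rfl⟩ := hx
          obtain ⟨y, hy, hyE, hxy⟩ := hE x hx
          exact ⟨τ y, fun _ => ⟨hy, ⟨y, hyE, rfl⟩, hτ.monotone hxy⟩⟩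
        · exact ⟨0, fun h => absurd h hx⟩
      choose f hf using hf
      have hb0 : b ∪ τ '' c ⊆ A := by
        rintro x (hx | ⟨x, hx, rfl⟩)
        · exact hb.1 hx
        · exact hcA hx
      refine ⟨(b ∪ τ '' c) ∪ f '' (b ∪ τ '' c), ⟨?_, ?_, ?_, ?_⟩, ?_⟩
      · rintro x (hx | ⟨x, hx, rfl⟩)
        · exact hb0 hx
        · exact (hf x (hb0 hx)).1
      · exact (hb.2.union (hcc.image τ)).union ((hb.2.union (hcc.image τ)).image f)
      · exact fun x hx => Or.inl (Or.inr hx)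
      · rintro x (hx | ⟨x, hx, rfl⟩)
        · exact ⟨f x, Or.inr ⟨x, hx, rfl⟩, (hf x (hb0 hx)).2⟩
        · exact ⟨f x, Or.inr ⟨x, hx, rfl⟩, (hf x (hb0 hx)).2.1, le_rfl⟩
      · exact fun x hx => Or.inl (Or.inl hx))
  refine hbad a ?_ ?_ ?_ ha
  · intro x hx
    exact hbA ⟨x, hx, rfl⟩
  · intro x hx
    obtain ⟨x', hx', h⟩ := hcb ⟨x, hx, rfl⟩
    rwa [← hτ.injective h]
  · intro x hx
    obtain ⟨_, ⟨y, hy, rfl⟩, ⟨y', hy', h⟩, hxy⟩ := hEb (τ x) ⟨x, hx, rfl⟩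
    rw [hτ.injective h] at hy'
    exact ⟨y, hy, hy', hτ.le_iff_le.1 hxy⟩

end

section

variable {L : Type} [LinearOrder L]

def FStat (T : Set L) : Prop :=
  ∀ F : L → L, ∃ δ ∈ T, (∃ x, x < δ) ∧ ∀ x < δ, F x < δ

theorem FStat.unb {T : Set L} (h : FStat T) (j : L) : ∃ i ∈ T, (∃ x, x < i) ∧ j < i := by
  obtain ⟨δ, hδ, ⟨x, hx⟩, hF⟩ := h (fun _ => j)
  exact ⟨δ, hδ, ⟨x, hx⟩, hF x hx⟩

theorem RegT.fstat_univ (R : RegT L) : FStat (univ : Set L) := by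
  intro F
  obtain ⟨δ, d, ho, h⟩ := R.omega_pt F
  exact ⟨δ, trivial, ⟨d 0, ho.lt 0⟩, h⟩

theorem FStat.union {S T : Set L} (h : FStat (S ∪ T)) : FStat S ∨ FStat T := by
  by_contra hcon
  simp only [FStat] at hcon
  push Not at hcon
  obtain ⟨⟨F, hF⟩, G, hG⟩ := hcon
  obtain ⟨δ, hδ | hδ, hne, hc⟩ := h (fun x => max (F x) (G x))
  · obtain ⟨x, hx, hx2⟩ := hF δ hδ hne
    exact absurd ((le_max_left _ _).trans_lt (hc x hx)) (not_lt.2 hx2)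
  · obtain ⟨x, hx, hx2⟩ := hG δ hδ hne
    exact absurd ((le_max_right _ _).trans_lt (hc x hx)) (not_lt.2 hx2)

theorem RegT.fodor (R : RegT L) {T : Set L} (hT : FStat T) (r : L → L)
    (hr : ∀ i ∈ T, (∃ x, x < i) → r i < i) : ∃ j, FStat {i | i ∈ T ∧ r i = j} := by
  by_contra hcon
  simp only [FStat] at hcon
  push Not at hcon
  choose F hF using hcon
  have : ∀ x, ∃ b, ∀ j ≤ x, ∀ x' ≤ x, F j x' < b := by
    intro x
    obtain ⟨b, hb⟩ := R.bdr (R.prod_lt (R.segc x) (R.segc x)) (fun p => F p.1.1 p.2.1)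
    exact ⟨b, fun j hj x' hx' => hb (⟨j, hj⟩, ⟨x', hx'⟩)⟩
  choose G hG using this
  obtain ⟨δ, hδ, hne, hc⟩ := hT G
  obtain ⟨x, hx, hx2⟩ := hF (r δ) δ ⟨hδ, rfl⟩ hne
  have h1 : max x (r δ) < δ := max_lt hx (hr δ hδ hne)
  exact absurd ((hG (max x (r δ)) (r δ) (le_max_right _ _) x (le_max_left _ _)).trans (hc _ h1))
    (not_lt.2 hx2)

theorem silver1 (R : RegT L) (X : Type) (lam : Cardinal.{0}) (hl : ℵ₀ ≤ lam)
    (hp : ∀ ν < lam, ν ^ #L < lam) (B : L → Set X) (hB : ∀ j, #(B j) < lam)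
    (T : Set L) (hT : FStat T) (J : Type) (f : J → L → X)
    (hf : ∀ a, ∀ i ∈ T, (∃ x, x < i) → ∃ j < i, f a i ∈ B j)
    (hd : ∀ a b, a ≠ b → ∃ j, ∀ i ∈ T, (∃ x, x < i) → j < i → f a i ≠ f b i) : #J ≤ lam := by
  classical
  have h1 : ∀ a, ∃ j, FStat {i | i ∈ T ∧ f a i ∈ B j} := by
    intro a
    have h2 : ∀ i, ∃ j, i ∈ T → (∃ x, x < i) → j < i ∧ f a i ∈ B j := by
      intro i
      by_cases h : i ∈ T ∧ ∃ x, x < i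
      · obtain ⟨j, hj⟩ := hf a i h.1 h.2
        exact ⟨j, fun _ _ => hj⟩
      · exact ⟨i, fun h1 h2 => absurd ⟨h1, h2⟩ h⟩
    choose r hr using h2
    obtain ⟨j, hj⟩ := R.fodor hT r (fun i hi hx => (hr i hi hx).1)
    refine ⟨j, fun F => ?_⟩
    obtain ⟨δ, ⟨hδ, rfl⟩, hne, hc⟩ := hj F
    exact ⟨δ, ⟨hδ, (hr δ hδ hne).2⟩, hne, hc⟩
  choose j hj using h1
  let Ψ : J → Σ j : L, (L → Option (B j)) := fun a =>
    ⟨j a, fun i => if h : f a i ∈ B (j a) then some ⟨f a i, h⟩ else none⟩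
  have hΨ : Function.Injective Ψ := by
    intro a b hab
    by_contra hne
    obtain ⟨i0, hi0⟩ := hd a b hne
    let Λ : (Σ j : L, (L → Option (B j))) → L → Option X := fun p i => (p.2 i).map Subtype.val
    obtain ⟨i, ⟨hiT, hiB⟩, hx, hi⟩ := (hj a).unb i0
    have h3 : Λ (Ψ a) i = Λ (Ψ b) i := by rw [hab]
    simp only [Λ, Ψ, hiB, dif_pos, Option.map_some] at h3
    by_cases h4 : f b i ∈ B (j b)
    · simp only [h4, dif_pos, Option.map_some, Option.some.injEq] at h3
      exact hi0 i hiT hx hi h3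
    · simp [h4] at h3
  have h5 := mk_le_of_injective hΨ
  rw [mk_sigma] at h5
  have h2 : (2 : Cardinal) < lam := lt_of_lt_of_le (by exact_mod_cast natCast_lt_aleph0 (n := 2)) hl
  have hL : #L ≤ lam := (cantor _).le.trans (hp 2 h2).le
  refine h5.trans ((sum_le_sum _ (fun _ => lam) fun j => ?_).trans ?_)
  · have h6 : #(Option (B j)) < lam := by
      rw [mk_option]
      exact add_lt_of_lt hl (hB j) (one_lt_aleph0.trans_le hl)
    have h7 := hp _ h6
    simpa using h7.le
  · rw [sum_const, lift_id, lift_id]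
    exact (mul_le_mul' hL le_rfl).trans (mul_eq_self hl).le

theorem silver2 (R : RegT L) (X : Type) (lam : Cardinal.{0}) (hl : ℵ₀ ≤ lam)
    (hp : ∀ ν < lam, ν ^ #L < lam) (B : L → Set X) (hB : ∀ j, #(B j) < lam)
    (Z : L → Type) [∀ i, LinearOrder (Z i)]
    (hZ : ∀ i (z : Z i), (∃ x, x < i) → #(Iic z) ≤ #(⋃ j : Iio i, B j : Set X))
    (J : Type) (f : J → ∀ i, Z i)
    (hd : ∀ a b, a ≠ b → ∃ j, ∀ i, (∃ x, x < i) → j < i → f a i ≠ f b i) :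
    #J ≤ Order.succ lam := by
  classical
  have h2 : (2 : Cardinal) < lam := lt_of_lt_of_le (by exact_mod_cast natCast_lt_aleph0 (n := 2)) hl
  let Fm : J → Set J := fun g => {a | FStat {i | f a i ≤ f g i}}
  have hFm : ∀ g, #(Fm g) ≤ lam := by
    intro g
    have he : ∀ i, ∃ e : Z i → Option X, (∃ x, x < i) → (∀ z ≤ f g i, ∃ j < i, ∃ w ∈ B j, e z = some w) ∧
        ∀ z ≤ f g i, ∀ z' ≤ f g i, e z = e z' → z = z' := by
      intro i
      by_cases hi : ∃ x, x < i
      · obtain ⟨e⟩ := hZ i (f g i) hi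
        refine ⟨fun z => if h : z ≤ f g i then some (e ⟨z, h⟩).1 else none, fun _ => ⟨?_, ?_⟩⟩
        · intro z hz
          obtain ⟨j, hj⟩ := mem_iUnion.1 (e ⟨z, hz⟩).2
          exact ⟨j.1, j.2, _, hj, by simp [hz]⟩
        · intro z hz z' hz' h
          simp only [hz, hz', dif_pos, Option.some.injEq] at h
          exact Subtype.mk.inj (e.injective (Subtype.ext h))
      · exact ⟨fun _ => none, fun h => absurd h hi⟩
    choose e he1 using he
    let τ : Fm g → Set L := fun a => {i | f a.1 i ≤ f g i}
    have hfib : ∀ T : Set L, #(τ ⁻¹' {T}) ≤ lam := by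
      intro T
      by_cases hT : FStat T
      · refine silver1 R (Option X) lam hl hp (fun j => some '' B j) (fun j => mk_image_le.trans_lt (hB j))
          T hT _ (fun a i => e i (f a.1.1 i)) ?_ ?_
        · rintro ⟨a, rfl⟩ i hi hx
          obtain ⟨j, hj, w, hw, h⟩ := (he1 i hx).1 (f a.1 i) hi
          exact ⟨j, hj, w, hw, h.symm⟩
        · rintro ⟨a, ha⟩ ⟨b, hb⟩ hab
          have hne : a.1 ≠ b.1 := fun h => hab (Subtype.ext (Subtype.ext h))
          obtain ⟨j, hj⟩ := hd _ _ hne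
          refine ⟨j, fun i hi hx hji heq => hj i hx hji ?_⟩
          have ha' : τ a = T := ha
          have hb' : τ b = T := hb
          have hia : i ∈ τ a := by rw [ha']; exact hi
          have hib : i ∈ τ b := by rw [hb']; exact hi
          exact (he1 i hx).2 _ hia _ hib heq
      · have : IsEmpty (τ ⁻¹' {T}) := by
          constructor
          rintro ⟨a, ha⟩
          have ha' : τ a = T := ha
          exact hT (ha' ▸ a.2)
        rw [mk_eq_zero]
        exact zero_le
    have h3 : #(Fm g) = Cardinal.sum (fun T : Set L => #(τ ⁻¹' {T})) := by
      rw [← mk_sigma]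
      exact (Cardinal.mk_congr (Equiv.sigmaFiberEquiv τ)).symm
    rw [h3]
    refine (sum_le_sum _ (fun _ => lam) hfib).trans ?_
    rw [sum_const, lift_id, lift_id, mk_set]
    exact (mul_le_mul' (hp 2 h2).le le_rfl).trans (mul_eq_self hl).le
  have htot : ∀ a g, a ∈ Fm g ∨ g ∈ Fm a := by
    intro a g
    apply FStat.union
    convert R.fstat_univ (L := L)
    ext i
    simp [le_total]
  clear_value Fm
  by_contra hcon
  push Not at hcon
  obtain ⟨G, hG⟩ := le_mk_iff_exists_set.1 hcon.le
  have hU : #(⋃ g : G, Fm g) < #J := by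
    refine lt_of_le_of_lt ?_ hcon
    have hs1 : #(⋃ g : G, Fm g.1) ≤ Cardinal.sum (fun g : G => #(Fm g.1)) := mk_iUnion_le_sum_mk
    have hs2 : Cardinal.sum (fun g : G => #(Fm g.1)) ≤ Cardinal.sum (fun _ : G => lam) :=
      sum_le_sum _ _ (fun g => hFm g.1)
    refine hs1.trans (hs2.trans ?_)
    rw [sum_const, lift_id, lift_id, hG]
    exact (mul_le_mul' le_rfl (Order.le_succ lam)).trans (mul_eq_self (hl.trans (Order.le_succ _))).le
  obtain ⟨a, ha⟩ : ∃ a, a ∉ ⋃ g : G, Fm g := by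
    by_contra h
    push Not at h
    rw [eq_univ_iff_forall.2 h, mk_univ] at hU
    exact lt_irrefl _ hU
  have hGa : G ⊆ Fm a := by
    intro g hg
    rcases htot a g with h | h
    · exact absurd (mem_iUnion.2 ⟨⟨g, hg⟩, h⟩) ha
    · exact h
  have := (mk_le_mk_of_subset hGa).trans (hFm a)
  rw [hG] at this
  exact absurd this (not_le.2 (Order.lt_succ lam))

end

theorem caseA {X : Type} [LinearOrder X] {I : Type} (hX : ℵ₀ ≤ #X) (hseg : ∀ x : X, #(Iic x) < #X)
    (hb : ∀ f : I → X, ∃ b, ∀ i, f i ≤ b) (hp : ∀ ν < #X, ν ^ #I < #X) : #(I → X) ≤ #X := by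
  choose b hb using hb
  let Ψ : (I → X) → Σ x : X, (I → Iic x) := fun f => ⟨b f, fun i => ⟨f i, hb f i⟩⟩
  have hΨ : Function.Injective Ψ := by
    intro f g h
    let Λ : (Σ x : X, (I → Iic x)) → I → X := fun p i => (p.2 i).1
    exact congrArg Λ h
  have h5 := mk_le_of_injective hΨ
  rw [mk_sigma] at h5
  refine h5.trans ((sum_le_sum _ (fun _ => #X) fun x => ?_).trans ?_)
  · have h7 := hp _ (hseg x)
    simpa using h7.le
  · rw [sum_const, lift_id]
    exact (mul_eq_self hX).le

open Classical in
/-- truncation -/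
noncomputable def trunc {X I : Type} (Y : Set X) (f : I → X) : I → Option Y :=
  fun t => if h : f t ∈ Y then some ⟨f t, h⟩ else none

theorem trunc_ne {X I : Type} {Y : Set X} {f g : I → X} {t : I} (h : f t ≠ g t) (hf : f t ∈ Y) :
    trunc Y f ≠ trunc Y g := by
  intro he
  have h1 := congrFun he t
  by_cases hg : g t ∈ Y
  · simp only [trunc, hf, hg, dif_pos, Option.some.injEq, Subtype.mk.injEq] at h1
    exact h h1
  · simp [trunc, hf, hg] at h1

theorem caseB {X : Type} [LinearOrder X] {I : Type} (hX : ℵ₀ ≤ #X) (hseg : ∀ x : X, #(Iic x) < #X)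
    (c : ℕ → X) (hc : ∀ x, ∃ n, x ≤ c n) (hp : ∀ ν < #X, ν ^ #I < #X) : #(I → X) ≤ #X ^ ℵ₀ := by
  have h1 : ∀ n, ∃ e : (I → Option (Iic (c n))) → X, Function.Injective e := by
    intro n
    have h6 : #(Option (Iic (c n))) < #X := by
      rw [mk_option]
      exact add_lt_of_lt hX (hseg _) (one_lt_aleph0.trans_le hX)
    have h7 : #(I → Option (Iic (c n))) ≤ #X := by
      have := (hp _ h6).le
      rwa [power_def] at this
    obtain ⟨e⟩ := h7
    exact ⟨e, e.injective⟩
  choose e he using h1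
  let Ψ : (I → X) → (ℕ → X) := fun f n => e n (trunc (Iic (c n)) f)
  have hΨ : Function.Injective Ψ := by
    intro f g h
    funext t
    by_contra hne
    obtain ⟨n, hn⟩ := hc (f t)
    exact trunc_ne hne hn (he n (congrFun h n))
  have := mk_le_of_injective hΨ
  rwa [← power_def X ℕ, mk_nat] at this

theorem caseC {Θ : Type} [LinearOrder Θ] (R : RegT Θ) {X : Type} [LinearOrder X] {I : Type}
    (hI : ℵ₀ ≤ #I) (hX : ℵ₀ ≤ #X) (hseg : ∀ x : X, #(Iic x) < #X)
    (hΘ : #Θ ≤ #I) (h2 : 2 ^ #I < #X) (g : Θ → X) (hg : ∀ x, ∃ j, x ≤ g j)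
    (hbd : ∀ i, ∃ b, ∀ j < i, g j ≤ b)
    (hp : ∀ ν < #X, ν ^ #I < #X)
    (hIH : ∀ ν < #X, 2 ^ #I ≤ ν → ν ^ #I ≤ Order.succ ν) : #(I → X) ≤ Order.succ #X := by
  obtain ⟨S0, hS0⟩ := le_mk_iff_exists_set.1 h2.le
  have hun : ∀ b, #(Iic b ∪ S0 : Set X) < #X := fun b =>
    (mk_union_le _ _).trans_lt (add_lt_of_lt hX (hseg b) (hS0.trans_lt h2))
  let B : Θ → Set X := fun j => Iic (g j) ∪ S0
  let Y : Θ → Set X := fun i => ⋃ j : Iio i, B j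
  have hY : ∀ i, #(Y i) < #X := by
    intro i
    obtain ⟨b, hb⟩ := hbd i
    refine (mk_le_mk_of_subset ?_).trans_lt (hun b)
    refine iUnion_subset fun j => ?_
    exact union_subset_union_left _ (Iic_subset_Iic.2 (hb j.1 j.2))
  have hYge : ∀ i, (∃ x, x < i) → 2 ^ #I ≤ #(Y i) := by
    rintro i ⟨x, hx⟩
    rw [← hS0]
    refine mk_le_mk_of_subset fun z hz => mem_iUnion.2 ⟨⟨x, hx⟩, Or.inr hz⟩
  have hinf : ∀ i, (∃ x, x < i) → ℵ₀ ≤ #(Y i) := fun i hi =>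
    (hI.trans (cantor _).le).trans (hYge i hi)
  have hcode : ∀ i, ∃ e : (I → Option (Y i)) → (Order.succ #(Y i)).ord.ToType,
      (∃ x, x < i) → Function.Injective e := by
    intro i
    by_cases hi : ∃ x, x < i
    · have h3 : #(I → Option (Y i)) ≤ #((Order.succ #(Y i)).ord.ToType) := by
        rw [mk_toType, card_ord, ← power_def, mk_option, add_one_eq (hinf i hi)]
        exact hIH _ (hY i) (hYge i hi)
      obtain ⟨e⟩ := h3
      exact ⟨e, fun _ => e.injective⟩
    · have : Nonempty (Order.succ #(Y i)).ord.ToType := by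
        rw [← mk_ne_zero_iff, mk_toType, card_ord]
        exact (Order.bot_lt_succ _).ne'
      exact ⟨fun _ => Classical.arbitrary _, fun h => absurd h hi⟩
  choose e he using hcode
  refine silver2 R X #X hX ?_ B (fun j => hun _) (fun i => (Order.succ #(Y i)).ord.ToType) ?_
    (I → X) (fun a i => e i (trunc (Y i) a)) ?_
  · intro ν hν
    rcases eq_or_ne ν 0 with rfl | h0
    · rw [zero_power (zero_lt_one.trans_le (one_lt_aleph0.le.trans R.unc.le)).ne']
      exact aleph0_pos.trans_le hX
    · exact (power_le_power_left h0 hΘ).trans_lt (hp ν hν)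
  · intro i z hi
    have h1 := (RegT.of_reg (isRegular_succ (hinf i hi))
      ((hinf i hi).trans_lt (Order.lt_succ _))).segc z
    exact Order.lt_succ_iff.1 (h1.trans_eq (by rw [mk_toType, card_ord]))
  · intro a b hab
    obtain ⟨t, ht⟩ := Function.ne_iff.1 hab
    obtain ⟨j, hj⟩ := hg (a t)
    refine ⟨j, fun i hi hji h => ?_⟩
    exact trunc_ne ht (mem_iUnion.2 ⟨⟨j, hji⟩, Or.inl hj⟩) (he i hi h)

/-- if for every cardinal `λ > ℵ₁` every stationary `𝒜 ⊆ [λ]^{ℵ₀}`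
reflects in some `A ⊆ λ` of cardinality `ℵ₁`, then the Singular Cardinal Hypothesis
holds: `λ^κ ≤ λ⁺ + 2^κ` for all infinite cardinals `λ, κ`. -/
theorem stmt4
    (hrefl : ∀ lam : Cardinal.{0}, Cardinal.aleph 1 < lam →
      ∀ 𝒜 : Set (Set Ordinal.{0}), 𝒜 ⊆ ctblInf (Set.Iio lam.ord) →
        StatFam (Set.Iio lam.ord) 𝒜 →
        ∃ A : Set Ordinal.{0}, A ⊆ Set.Iio lam.ord ∧
          #A = Cardinal.aleph 1 ∧ Reflects 𝒜 A) :
    ∀ lam kap : Cardinal.{0}, ℵ₀ ≤ lam → ℵ₀ ≤ kap →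
      lam ^ kap ≤ Order.succ lam + 2 ^ kap := by
  intro lam
  induction lam using WellFoundedLT.induction with
  | ind lam IH =>
  intro kap hl hk
  rcases le_or_gt lam (2 ^ kap) with hle | h2
  · refine (power_le_power_right hle).trans ?_
    rw [← power_mul, mul_eq_self hk]
    exact le_add_self
  refine le_trans ?_ le_self_add
  have hk2 : ℵ₀ ≤ (2 : Cardinal) ^ kap := hk.trans (cantor _).le
  have hν : ∀ ν < lam, ν ^ kap ≤ lam := by
    intro ν hν
    rcases lt_or_ge ν ℵ₀ with hf | hi
    · refine (power_le_power_right (hf.le.trans hk2)).trans ?_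
      rw [← power_mul, mul_eq_self hk]
      exact h2.le
    · exact (IH ν hν kap hi hk).trans (add_le_of_le hl (Order.succ_le_of_lt hν) h2.le)
  by_cases hex : ∃ ν < lam, ν ^ kap = lam
  · obtain ⟨ν, _, h⟩ := hex
    have : lam ^ kap = lam := by
      conv_lhs => rw [← h]
      rw [← power_mul, mul_eq_self hk, h]
    exact this.le.trans (Order.le_succ _)
  push Not at hex
  have hp : ∀ ν < lam, ν ^ kap < lam := fun ν h => lt_of_le_of_ne (hν ν h) (hex ν h)
  have hIH : ∀ ν < lam, 2 ^ kap ≤ ν → ν ^ kap ≤ Order.succ ν := by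
    intro ν h1 h3
    have h4 := hk2.trans h3
    exact (IH ν h1 kap h4 hk).trans (add_le_of_le (h4.trans (Order.le_succ _)) le_rfl
      (h3.trans (Order.le_succ _)))
  obtain ⟨X, iX, hXl, hseg, hcofX⟩ : ∃ (X : Type) (_ : LinearOrder X), #X = lam ∧
      (∀ x : X, #(Iic x) < #X) ∧ Order.cof X = lam.ord.cof := by
    refine ⟨lam.ord.ToType, inferInstance, by simp, fun x => ?_, Ordinal.cof_toType _⟩
    have := Cardinal.noMaxOrder hl
    obtain ⟨y, hy⟩ := exists_gt x
    refine (mk_le_mk_of_subset (fun z (hz : z ≤ x) => lt_of_le_of_lt hz hy)).trans_lt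
      ((mk_Iio_toType_ord_lt y).trans_eq (by simp))
  have hreg : (lam.ord.cof).IsRegular := isRegular_cof (isSuccLimit_ord hl)
  obtain ⟨S, hS, hSc⟩ := Order.exists_cof_eq X
  have hbound : ∀ T : Set X, #T < lam.ord.cof → ∃ b, ∀ y ∈ T, y < b := by
    intro T hT
    rw [← not_isCofinal_iff]
    intro h
    exact absurd (Order.cof_le h) (not_le.2 (hT.trans_eq hcofX.symm))
  rw [hcofX] at hSc
  generalize hθ : lam.ord.cof = θ at *
  obtain ⟨I, rfl⟩ : ∃ I : Type, #I = kap := ⟨kap.out, by simp⟩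
  subst hXl
  rw [power_def]
  rcases lt_or_ge #I θ with hc | hc
  · refine (caseA hl hseg (fun f => ?_) hp).trans (Order.le_succ _)
    obtain ⟨b, hb⟩ := hbound (range f) (mk_range_le.trans_lt hc)
    exact ⟨b, fun i => (hb _ ⟨i, rfl⟩).le⟩
  rcases hreg.aleph0_le.eq_or_lt with h0 | hunc
  · have hSn : #S = #ℕ := by rw [hSc, ← h0, mk_nat]
    obtain ⟨e⟩ := Cardinal.eq.1 hSn
    have hcn : ∀ x, ∃ n, x ≤ (e.symm n).1 := by
      intro x
      obtain ⟨y, hy, hxy⟩ := hS x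
      exact ⟨e ⟨y, hy⟩, by simpa using hxy⟩
    refine (caseB hl hseg (fun n => (e.symm n).1) hcn hp).trans ?_
    refine main1 hrefl X hl (fun n => Iic (e.symm n).1) hcn (fun n => hseg _) ?_
    intro ν hν
    rcases eq_or_ne ν 0 with rfl | h0
    · rw [zero_power aleph0_pos.ne']
      exact aleph0_pos.trans_le hl
    · exact (power_le_power_left h0 hk).trans_lt (hp ν hν)
  · have hSn : #S = #θ.ord.ToType := by rw [hSc]; simp
    obtain ⟨e⟩ := Cardinal.eq.1 hSn
    refine caseC (RegT.of_reg hreg hunc) hk hl hseg (by simpa using hc) h2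
      (fun j => (e.symm j).1) ?_ ?_ hp hIH
    · intro x
      obtain ⟨y, hy, hxy⟩ := hS x
      exact ⟨e ⟨y, hy⟩, by simpa using hxy⟩
    · intro i
      obtain ⟨b, hb⟩ := hbound ((fun j => (e.symm j).1) '' Iio i)
        (mk_image_le.trans_lt (mk_Iio_toType_ord_lt i))
      exact ⟨b, fun j hj => (hb _ ⟨j, hj, rfl⟩).le⟩

end ReflSCH
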